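/- Let d ≥ 2 and for ξ > 0 define f_ξ(ν) = C̄_1 ν^{(d-1)/d} − 4ν + 4ξ^{-(d+1)} ν^2 for ν ≥ 0. Then there is a crossover at ξ_d: if 0 < ξ < ξ_d then f_ξ(ν) ≥ 0 for all ν ≥ 0, while if ξ > ξ_d then inf_{ν ≥ 0} f_ξ(ν) < 0 and the infimum is attained at some strictly positive ν (so f_ξ has a strictly positive global minimizer). -/

import Mathlib

open MeasureTheory Real Filter Topology

noncomputable section

/-- `σ_d`, the surface area of the unit sphere in `ℝ^d`. -/
def sphereArea (d : ℕ) : ℝ :=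
  d * (volume (Metric.ball (0 : EuclideanSpace ℝ (Fin d)) 1)).toReal

/-- `c₀ = 2√2/3`, the cost of a one-dimensional transition layer. -/
def c₀ : ℝ := 2 * Real.sqrt 2 / 3

/-- `C̄₁ = c₀ σ_d^{1/d} d^{(d-1)/d}`. -/
def C1bar (d : ℕ) : ℝ := c₀ * sphereArea d ^ ((1 : ℝ) / d) * (d : ℝ) ^ (((d : ℝ) - 1) / d)

/-- `ξ_d = c₀^{d/(d+1)} σ_d^{1/(d+1)} (d+1) / (4^{d/(d+1)} d^{1/(d+1)})`. -/
def xiCrit (d : ℕ) : ℝ :=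
  c₀ ^ ((d : ℝ) / ((d : ℝ) + 1)) * sphereArea d ^ ((1 : ℝ) / ((d : ℝ) + 1)) * ((d : ℝ) + 1) /
    ((4 : ℝ) ^ ((d : ℝ) / ((d : ℝ) + 1)) * (d : ℝ) ^ ((1 : ℝ) / ((d : ℝ) + 1)))

/-- `f_ξ(ν) = C̄₁ ν^{(d-1)/d} - 4ν + 4 ξ^{-(d+1)} ν²`. -/
def fxi (d : ℕ) (ξ ν : ℝ) : ℝ :=
  C1bar d * ν ^ (((d : ℝ) - 1) / d) - 4 * ν + 4 * ξ ^ (-((d : ℝ) + 1)) * ν ^ 2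

theorem sphereArea_pos {d : ℕ} (hd : 0 < d) : 0 < sphereArea d := by
  have hball : 0 < volume (Metric.ball (0 : EuclideanSpace ℝ (Fin d)) 1) :=
    Metric.measure_ball_pos _ _ one_pos
  have hd' : (0 : ℝ) < d := by exact_mod_cast hd
  exact mul_pos hd' (ENNReal.toReal_pos hball.ne' measure_ball_lt_top.ne)

theorem c₀_pos : 0 < c₀ := by
  unfold c₀
  positivity

theorem C1bar_pos {d : ℕ} (hd : 0 < d) : 0 < C1bar d := by
  have hσ := sphereArea_pos hd
  have hc := c₀_pos
  have hd' : (0 : ℝ) < d := by exact_mod_cast hd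
  unfold C1bar
  positivity

theorem xiCrit_pos {d : ℕ} (hd : 0 < d) : 0 < xiCrit d := by
  have hσ := sphereArea_pos hd
  have hc := c₀_pos
  have hd' : (0 : ℝ) < d := by exact_mod_cast hd
  unfold xiCrit
  positivity

theorem rpow_div_natCast_pow {x : ℝ} (hx : 0 ≤ x) (y : ℝ) {n : ℕ} (hn : n ≠ 0) :
    (x ^ (y / n)) ^ n = x ^ y := by
  have hn' : (n : ℝ) ≠ 0 := by exact_mod_cast hn
  rw [← rpow_mul_natCast hx, div_mul_cancel₀ _ hn']

theorem C1bar_pow_mul {d : ℕ} (hd : 0 < d) :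
    C1bar d ^ d * d = c₀ ^ d * sphereArea d * (d : ℝ) ^ d := by
  have hσ := sphereArea_pos hd
  have hd' : (0 : ℝ) < d := by exact_mod_cast hd
  rw [C1bar, mul_pow, mul_pow, rpow_div_natCast_pow hσ.le _ hd.ne',
    rpow_div_natCast_pow hd'.le _ hd.ne', rpow_one, rpow_sub_one hd'.ne', rpow_natCast]
  field_simp

theorem xiCrit_pow {d : ℕ} (hd : 0 < d) :
    xiCrit d ^ (d + 1) = c₀ ^ d * sphereArea d * ((d : ℝ) + 1) ^ (d + 1) / (4 ^ d * d) := by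
  have hσ := sphereArea_pos hd
  have hd' : (0 : ℝ) < d := by exact_mod_cast hd
  have key : ∀ {x : ℝ}, 0 ≤ x → ∀ y : ℝ, (x ^ (y / ((d : ℝ) + 1))) ^ (d + 1) = x ^ y := by
    intro x hx y
    have := rpow_div_natCast_pow hx y d.succ_ne_zero
    rwa [Nat.cast_succ] at this
  rw [xiCrit, div_pow, mul_pow, mul_pow, mul_pow, key c₀_pos.le, key hσ.le,
    key (by norm_num : (0 : ℝ) ≤ 4), key hd'.le]
  simp only [rpow_natCast, rpow_one]

/-- The radius variable `t = ν^{1/d}` at which `f_{ξ_d}` vanishes to second order. -/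
def critRadius (d : ℕ) : ℝ := C1bar d * ((d : ℝ) + 1) / (4 * d)

theorem critRadius_pos {d : ℕ} (hd : 0 < d) : 0 < critRadius d := by
  have hC := C1bar_pos hd
  have hd' : (0 : ℝ) < d := by exact_mod_cast hd
  unfold critRadius
  positivity

theorem xiCrit_pow_eq_critRadius_pow {d : ℕ} (hd : 0 < d) :
    xiCrit d ^ (d + 1) = ((d : ℝ) + 1) * critRadius d ^ d := by
  have hd' : (0 : ℝ) < d := by exact_mod_cast hd
  rw [xiCrit_pow hd, critRadius, div_pow, mul_pow, mul_pow]
  have h := C1bar_pow_mul hd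
  field_simp
  linear_combination (-((d : ℝ) + 1) ^ (d + 1)) * h

theorem rpow_neg_natCast_add_one (d : ℕ) {ξ : ℝ} (hξ : 0 < ξ) :
    ξ ^ (-((d : ℝ) + 1)) = (ξ ^ (d + 1))⁻¹ := by
  rw [rpow_neg hξ.le, ← Nat.cast_succ, rpow_natCast]

theorem fxi_pow {d : ℕ} (hd : 0 < d) {ξ t : ℝ} (hξ : 0 < ξ) (ht : 0 < t) :
    fxi d ξ (t ^ d) = t ^ d / t * (C1bar d - 4 * t + 4 * (ξ ^ (d + 1))⁻¹ * t ^ (d + 1)) := by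
  have hd' : (0 : ℝ) < d := by exact_mod_cast hd
  have hp : (t ^ d) ^ (((d : ℝ) - 1) / d) = t ^ d / t := by
    rw [← rpow_natCast_mul ht.le, mul_div_cancel₀ _ hd'.ne', rpow_sub_one ht.ne', rpow_natCast]
  rw [fxi, hp, rpow_neg_natCast_add_one d hξ]
  field_simp
  ring

theorem fxi_zero {d : ℕ} (hd : 2 ≤ d) (ξ : ℝ) : fxi d ξ 0 = 0 := by
  have hd' : (2 : ℝ) ≤ d := by exact_mod_cast hd
  have h : ((d : ℝ) - 1) / d ≠ 0 := (div_pos (by linarith) (by linarith)).ne'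
  simp [fxi, zero_rpow h]

theorem continuous_fxi {d : ℕ} (hd : 2 ≤ d) (ξ : ℝ) : Continuous (fxi d ξ) := by
  have hd' : (2 : ℝ) ≤ d := by exact_mod_cast hd
  have h : 0 ≤ ((d : ℝ) - 1) / d := div_nonneg (by linarith) (by linarith)
  have hc : Continuous fun ν : ℝ => ν ^ (((d : ℝ) - 1) / d) := continuous_rpow_const h
  unfold fxi
  fun_prop

theorem fxi_nonneg_of_lt_xiCrit {d : ℕ} (hd : 2 ≤ d) {ξ ν : ℝ} (hξ : 0 < ξ)
    (h : ξ < xiCrit d) (hν : 0 ≤ ν) : 0 ≤ fxi d ξ ν := by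
  have hd0 : 0 < d := by omega
  have hd' : (0 : ℝ) < d := by exact_mod_cast hd0
  have hs := critRadius_pos hd0
  rcases hν.eq_or_lt with rfl | hν
  · exact (fxi_zero hd ξ).ge
  obtain ⟨u, hu, rfl⟩ : ∃ u : ℝ, 0 < u ∧ (critRadius d * u) ^ d = ν := by
    refine ⟨ν ^ ((d : ℝ)⁻¹) / critRadius d, by positivity, ?_⟩
    rw [mul_div_cancel₀ _ hs.ne', rpow_inv_natCast_pow hν.le hd0.ne']
  rw [fxi_pow hd0 hξ (by positivity)]
  refine mul_nonneg (by positivity) ?_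
  have hK : (((d : ℝ) + 1) * critRadius d ^ d)⁻¹ ≤ (ξ ^ (d + 1))⁻¹ := by
    rw [← xiCrit_pow_eq_critRadius_pow hd0]
    gcongr
  have hC : C1bar d = 4 * d * critRadius d / ((d : ℝ) + 1) := by
    unfold critRadius
    field_simp
  have hB := one_add_mul_le_pow (a := u - 1) (by linarith) (d + 1)
  push_cast at hB
  rw [add_sub_cancel] at hB
  calc (0 : ℝ) ≤ 4 * critRadius d / ((d : ℝ) + 1) * (d - (d + 1) * u + u ^ (d + 1)) :=
        mul_nonneg (by positivity) (by linarith)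
    _ = C1bar d - 4 * (critRadius d * u) +
          4 * (((d : ℝ) + 1) * critRadius d ^ d)⁻¹ * (critRadius d * u) ^ (d + 1) := by
        rw [hC, mul_pow]
        field_simp
        ring
    _ ≤ _ := by gcongr

theorem fxi_critRadius_pow_neg {d : ℕ} (hd : 0 < d) {ξ : ℝ} (hξ : 0 < ξ)
    (h : xiCrit d < ξ) : fxi d ξ (critRadius d ^ d) < 0 := by
  have hd' : (0 : ℝ) < d := by exact_mod_cast hd
  have hs := critRadius_pos hd
  have hX := xiCrit_pos hd
  rw [fxi_pow hd hξ hs]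
  refine mul_neg_of_pos_of_neg (by positivity) ?_
  have hK : (ξ ^ (d + 1))⁻¹ < (((d : ℝ) + 1) * critRadius d ^ d)⁻¹ := by
    rw [← xiCrit_pow_eq_critRadius_pow hd]
    gcongr
  have hC : C1bar d = 4 * d * critRadius d / ((d : ℝ) + 1) := by
    unfold critRadius
    field_simp
  calc C1bar d - 4 * critRadius d + 4 * (ξ ^ (d + 1))⁻¹ * critRadius d ^ (d + 1)
      < C1bar d - 4 * critRadius d +
          4 * (((d : ℝ) + 1) * critRadius d ^ d)⁻¹ * critRadius d ^ (d + 1) := by gcongr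
    _ = 0 := by
        rw [hC]
        field_simp
        ring

theorem fxi_nonneg_of_le {d : ℕ} (hd : 0 < d) {ξ ν : ℝ} (hξ : 0 < ξ)
    (h : ξ ^ (d + 1) ≤ ν) : 0 ≤ fxi d ξ ν := by
  have hpow : 0 < ξ ^ (d + 1) := by positivity
  have hν : 0 < ν := hpow.trans_le h
  have h1 : 0 ≤ C1bar d * ν ^ (((d : ℝ) - 1) / d) :=
    mul_nonneg (C1bar_pos hd).le (rpow_nonneg hν.le _)
  have h2 : 1 ≤ (ξ ^ (d + 1))⁻¹ * ν := by
    rwa [inv_mul_eq_div, one_le_div hpow]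
  rw [fxi, rpow_neg_natCast_add_one d hξ]
  nlinarith [mul_le_mul_of_nonneg_right h2 hν.le]

/-- **Crossover at `ξ_d`.** If `0 < ξ < ξ_d` then `f_ξ(ν) ≥ 0` for all `ν ≥ 0`, while if
`ξ > ξ_d` then `inf_{ν ≥ 0} f_ξ(ν) < 0` and the infimum is attained at a strictly
positive global minimizer. -/
theorem fxi_crossover (d : ℕ) (hd : 2 ≤ d) (ξ : ℝ) (hξ : 0 < ξ) :
    (ξ < xiCrit d → ∀ ν : ℝ, 0 ≤ ν → 0 ≤ fxi d ξ ν) ∧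
    (xiCrit d < ξ → ∃ νmin : ℝ, 0 < νmin ∧ fxi d ξ νmin < 0 ∧
      ∀ ν : ℝ, 0 ≤ ν → fxi d ξ νmin ≤ fxi d ξ ν) := by
  refine ⟨fun h ν hν => fxi_nonneg_of_lt_xiCrit hd hξ h hν, fun h => ?_⟩
  have hd0 : 0 < d := by omega
  have hneg := fxi_critRadius_pow_neg hd0 hξ h
  have hs : 0 ≤ critRadius d ^ d := (pow_pos (critRadius_pos hd0) d).le
  have hsR : critRadius d ^ d ≤ ξ ^ (d + 1) := by
    by_contra! hlt
    exact absurd (fxi_nonneg_of_le hd0 hξ hlt.le) hneg.not_ge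
  obtain ⟨m, hm, hmin⟩ := isCompact_Icc.exists_isMinOn ⟨_, Set.mem_Icc.2 ⟨hs, hsR⟩⟩
    (continuous_fxi hd ξ).continuousOn
  have hm_neg : fxi d ξ m < 0 := (hmin (Set.mem_Icc.2 ⟨hs, hsR⟩)).trans_lt hneg
  refine ⟨m, hm.1.lt_of_ne ?_, hm_neg, fun ν hν => ?_⟩
  · rintro rfl
    exact hm_neg.ne (fxi_zero hd ξ)
  · rcases le_total ν (ξ ^ (d + 1)) with hle | hle
    · exact hmin (Set.mem_Icc.2 ⟨hν, hle⟩)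
    · exact hm_neg.le.trans (fxi_nonneg_of_le hd0 hξ hle)
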